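/- arXiv:2401.16134 — 5 statements merged into one kernel-verified Lean document; each statement's English description precedes it below -/
import Mathlib

section
/- Let η_A, η_B, η_C ∈ (0,1] be detection efficiencies and let m_{ijk} (for (i,j,k) ∈ {0,1}³), q, r, s be real numbers in [0,1] satisfying m_{111} ≤ min(q,r,s), m_{110} ≤ q, m_{011} ≤ r, m_{101} ≤ s, and m_{ijk} ≥ 0 for all i,j,k. Define the observed T₂-expression B := −2(η_Aη_B·q + η_Bη_C·r + η_Aη_C·s) − η_Aη_Bη_C·(m_{001} + m_{010} + m_{100}) + 2η_Aη_Bη_C·(m_{110} + m_{101} + m_{011} + m_{111}). Then B ≤ 2·(4η_Aη_Bη_C − η_Aη_B − η_Aη_C − η_Bη_C)·min(q,r,s). -/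
/-- Detection-loophole bound on the observed `T₂` Bell expression.
If `ηA, ηB, ηC ∈ (0,1]` are detection efficiencies, `m i j k` are theoretical
all-zero-outcome probabilities and `q, r, s` are theoretical pair marginals
(with the marginal-consistency constraints `m 1 1 1 ≤ min q r s`, `m 1 1 0 ≤ q`,
`m 0 1 1 ≤ r`, `m 1 0 1 ≤ s`), then the observed T₂-expression `B` satisfies
`B ≤ 2 (4 ηA ηB ηC − ηA ηB − ηA ηC − ηB ηC) · min q r s`. -/
theorem t2_observed_expression_upper_bound
    (ηA ηB ηC : ℝ)
    (hηA : 0 < ηA ∧ ηA ≤ 1) (hηB : 0 < ηB ∧ ηB ≤ 1) (hηC : 0 < ηC ∧ ηC ≤ 1)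
    (m : Fin 2 → Fin 2 → Fin 2 → ℝ)
    (hm01 : ∀ i j k : Fin 2, 0 ≤ m i j k ∧ m i j k ≤ 1)
    (q r s : ℝ)
    (hq01 : 0 ≤ q ∧ q ≤ 1) (hr01 : 0 ≤ r ∧ r ≤ 1) (hs01 : 0 ≤ s ∧ s ≤ 1)
    (hm111 : m 1 1 1 ≤ min q (min r s))
    (hm110 : m 1 1 0 ≤ q) (hm011 : m 0 1 1 ≤ r) (hm101 : m 1 0 1 ≤ s)
    (B : ℝ)
    (hB : B = -2 * (ηA * ηB * q + ηB * ηC * r + ηA * ηC * s)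
        - ηA * ηB * ηC * (m 0 0 1 + m 0 1 0 + m 1 0 0)
        + 2 * (ηA * ηB * ηC) * (m 1 1 0 + m 1 0 1 + m 0 1 1 + m 1 1 1)) :
    B ≤ 2 * (4 * ηA * ηB * ηC - ηA * ηB - ηA * ηC - ηB * ηC) * min q (min r s) := by
  obtain ⟨a0, a1⟩ := hηA
  obtain ⟨b0, b1⟩ := hηB
  obtain ⟨c0, c1⟩ := hηC
  have hq : min q (min r s) ≤ q := min_le_left _ _
  have hr : min q (min r s) ≤ r := (min_le_right _ _).trans (min_le_left _ _)
  have hs : min q (min r s) ≤ s := (min_le_right _ _).trans (min_le_right _ _)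
  generalize min q (min r s) = t at *
  have hE : 0 < ηA * ηB * ηC := by positivity
  have e1 := mul_nonneg hE.le (sub_nonneg.2 hm110)
  have e2 := mul_nonneg hE.le (sub_nonneg.2 hm011)
  have e3 := mul_nonneg hE.le (sub_nonneg.2 hm101)
  have e4 := mul_nonneg hE.le (sub_nonneg.2 hm111)
  have e5 := mul_nonneg hE.le (hm01 0 0 1).1
  have e6 := mul_nonneg hE.le (hm01 0 1 0).1
  have e7 := mul_nonneg hE.le (hm01 1 0 0).1
  have f1 := mul_nonneg (mul_nonneg (mul_pos a0 b0).le (sub_nonneg.2 c1)) (sub_nonneg.2 hq)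
  have f2 := mul_nonneg (mul_nonneg (mul_pos b0 c0).le (sub_nonneg.2 a1)) (sub_nonneg.2 hr)
  have f3 := mul_nonneg (mul_nonneg (mul_pos a0 c0).le (sub_nonneg.2 b1)) (sub_nonneg.2 hs)
  rw [hB]
  linarith
end

section
/- Let η_A, η_B, η_C ∈ (0,1] and let m_{ijk} (for (i,j,k) ∈ {0,1}³), q, r, s be real numbers in [0,1] satisfying m_{111} ≤ min(q,r,s), m_{110} ≤ q, m_{011} ≤ r, m_{101} ≤ s, and m_{ijk} ≥ 0 for all i,j,k. If the observed T₂-expression B := −2(η_Aη_B·q + η_Bη_C·r + η_Aη_C·s) − η_Aη_Bη_C·(m_{001} + m_{010} + m_{100}) + 2η_Aη_Bη_C·(m_{110} + m_{101} + m_{011} + m_{111}) satisfies B > 0, then 4η_Aη_Bη_C − η_Aη_B − η_Aη_C − η_Bη_C > 0. -/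
/-- Lemma 1 of the paper. A violation `B > 0` of the observed
`T₂` inequality is impossible unless the detection efficiencies satisfy
`4 ηA ηB ηC − ηA ηB − ηA ηC − ηB ηC > 0`. -/
theorem t2_violation_necessary_efficiency_condition
    (ηA ηB ηC : ℝ)
    (hηA : 0 < ηA ∧ ηA ≤ 1) (hηB : 0 < ηB ∧ ηB ≤ 1) (hηC : 0 < ηC ∧ ηC ≤ 1)
    (m : Fin 2 → Fin 2 → Fin 2 → ℝ)
    (hm01 : ∀ i j k : Fin 2, 0 ≤ m i j k ∧ m i j k ≤ 1)
    (q r s : ℝ)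
    (hq01 : 0 ≤ q ∧ q ≤ 1) (hr01 : 0 ≤ r ∧ r ≤ 1) (hs01 : 0 ≤ s ∧ s ≤ 1)
    (hm111 : m 1 1 1 ≤ min q (min r s))
    (hm110 : m 1 1 0 ≤ q) (hm011 : m 0 1 1 ≤ r) (hm101 : m 1 0 1 ≤ s)
    (B : ℝ)
    (hB : B = -2 * (ηA * ηB * q + ηB * ηC * r + ηA * ηC * s)
        - ηA * ηB * ηC * (m 0 0 1 + m 0 1 0 + m 1 0 0)
        + 2 * (ηA * ηB * ηC) * (m 1 1 0 + m 1 0 1 + m 0 1 1 + m 1 1 1))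
    (hviol : B > 0) :
    4 * ηA * ηB * ηC - ηA * ηB - ηA * ηC - ηB * ηC > 0 := by
  obtain ⟨a0, a1⟩ := hηA
  obtain ⟨b0, b1⟩ := hηB
  obtain ⟨c0, c1⟩ := hηC
  have hE : 0 ≤ ηA * ηB * ηC := by positivity
  have tq : m 1 1 1 ≤ q := hm111.trans (min_le_left _ _)
  have tr : m 1 1 1 ≤ r := hm111.trans ((min_le_right _ _).trans (min_le_left _ _))
  have ts : m 1 1 1 ≤ s := hm111.trans ((min_le_right _ _).trans (min_le_right _ _))
  have t0 := (hm01 1 1 1).1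
  have n1 := mul_nonneg hE (hm01 0 0 1).1
  have n2 := mul_nonneg hE (hm01 0 1 0).1
  have n3 := mul_nonneg hE (hm01 1 0 0).1
  have h1 := mul_nonneg hE (sub_nonneg.2 hm110)
  have h2 := mul_nonneg hE (sub_nonneg.2 hm011)
  have h3 := mul_nonneg hE (sub_nonneg.2 hm101)
  have k1 := mul_nonneg (mul_nonneg (mul_nonneg a0.le b0.le) (sub_nonneg.2 c1)) (sub_nonneg.2 tq)
  have k2 := mul_nonneg (mul_nonneg (mul_nonneg b0.le c0.le) (sub_nonneg.2 a1)) (sub_nonneg.2 tr)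
  have k3 := mul_nonneg (mul_nonneg (mul_nonneg a0.le c0.le) (sub_nonneg.2 b1)) (sub_nonneg.2 ts)
  have key : 0 < m 1 1 1 * (4 * ηA * ηB * ηC - ηA * ηB - ηA * ηC - ηB * ηC) := by
    rw [hB] at hviol
    linarith
  exact pos_of_mul_pos_right key t0
end

section
/- Let η_A, η_B, η_C ∈ (0,1]. There exists θ ∈ (0,π) such that 2 k_θ² sin⁴θ · [4η_Aη_Bη_C − Σ − tan²(θ/2)·Σ] > 0 (where Σ := η_Aη_B + η_Bη_C + η_Aη_C and k_θ := sin θ / √(3 sin²θ + (1 − 3cos θ)²)) if and only if 4η_Aη_Bη_C − η_Aη_B − η_Bη_C − η_Aη_C > 0. -/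
/-- Lemmas 1 and 2 of the paper combined. The one-parameter
quantum settings exhibit a loophole-free `T₂` violation for some `θ ∈ (0,π)`
if and only if `4 ηA ηB ηC − ηA ηB − ηB ηC − ηA ηC > 0`. -/
theorem exists_theta_t2_violation_iff
    (ηA ηB ηC : ℝ)
    (hηA : 0 < ηA ∧ ηA ≤ 1) (hηB : 0 < ηB ∧ ηB ≤ 1) (hηC : 0 < ηC ∧ ηC ≤ 1) :
    (∃ θ ∈ Set.Ioo 0 Real.pi,
        0 < 2 * (Real.sin θ / Real.sqrt (3 * Real.sin θ ^ 2 + (1 - 3 * Real.cos θ) ^ 2)) ^ 2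
            * Real.sin θ ^ 4
            * (4 * (ηA * ηB * ηC) - (ηA * ηB + ηB * ηC + ηA * ηC)
              - Real.tan (θ / 2) ^ 2 * (ηA * ηB + ηB * ηC + ηA * ηC)))
      ↔ 0 < 4 * (ηA * ηB * ηC) - ηA * ηB - ηB * ηC - ηA * ηC := by
  obtain ⟨hA, -⟩ := hηA
  obtain ⟨hB, -⟩ := hηB
  obtain ⟨hC, -⟩ := hηC
  have hS : 0 < ηA * ηB + ηB * ηC + ηA * ηC := by positivity
  constructor
  · rintro ⟨θ, -, h⟩
    have h1 := pos_of_mul_pos_right h (by positivity)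
    have h2 : 0 ≤ Real.tan (θ / 2) ^ 2 * (ηA * ηB + ηB * ηC + ηA * ηC) := by positivity
    linarith
  · intro h
    obtain ⟨D, hD⟩ : ∃ D, D = 4 * (ηA * ηB * ηC) - (ηA * ηB + ηB * ηC + ηA * ηC) := ⟨_, rfl⟩
    have hDpos : 0 < D := by linarith
    rw [← hD]
    obtain ⟨S, hSd⟩ : ∃ S, S = ηA * ηB + ηB * ηC + ηA * ηC := ⟨_, rfl⟩
    rw [← hSd] at hS ⊢
    have ht : 0 < Real.sqrt (D / (2 * S)) := Real.sqrt_pos.2 (by positivity)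
    have h1 : 0 < Real.arctan (Real.sqrt (D / (2 * S))) := Real.arctan_pos.2 ht
    have h2 := Real.arctan_lt_pi_div_two (Real.sqrt (D / (2 * S)))
    have hm : 2 * Real.arctan (Real.sqrt (D / (2 * S))) ∈ Set.Ioo 0 Real.pi :=
      ⟨by linarith, by linarith⟩
    refine ⟨_, hm, ?_⟩
    have hs := Real.sin_pos_of_mem_Ioo hm
    rw [mul_div_cancel_left₀ _ (two_ne_zero' ℝ), Real.tan_arctan,
      Real.sq_sqrt (by positivity)]
    have h3 : D - D / (2 * S) * S = D / 2 := by field_simp; ring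
    rw [h3]
    positivity
end

section
/- Let η ∈ (0,1] and set η_A = η_B = η_C = η. Then there exists θ ∈ (0,π) with 2 k_θ² sin⁴θ · [4η³ − 3η² − tan²(θ/2)·3η²] > 0 (where k_θ := sin θ / √(3 sin²θ + (1 − 3cos θ)²)) if and only if η > 3/4. Equivalently, 4η³ − 3η² > 0 if and only if η > 3/4. -/
/-- symmetric-detector consequence of Theorem 1. With three
detectors of common efficiency `η ∈ (0,1]`, the one-parameter quantum settings
exhibit a loophole-free `T₂` violation for some `θ ∈ (0,π)` if and only if
`η > 3/4`; equivalently, `4η³ − 3η² > 0` iff `η > 3/4`. -/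
theorem symmetric_t2_mde_three_quarters
    (η : ℝ) (hη : 0 < η ∧ η ≤ 1) :
    ((∃ θ ∈ Set.Ioo 0 Real.pi,
        0 < 2 * (Real.sin θ / Real.sqrt (3 * Real.sin θ ^ 2 + (1 - 3 * Real.cos θ) ^ 2)) ^ 2
            * Real.sin θ ^ 4
            * (4 * η ^ 3 - 3 * η ^ 2 - Real.tan (θ / 2) ^ 2 * (3 * η ^ 2)))
      ↔ 3 / 4 < η) ∧
    (0 < 4 * η ^ 3 - 3 * η ^ 2 ↔ 3 / 4 < η) := by
  obtain ⟨h0, h1⟩ := hη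
  have h2 : 0 < η ^ 2 := by positivity
  have key : 0 < 4 * η ^ 3 - 3 * η ^ 2 ↔ 3 / 4 < η := by
    have e : 4 * η ^ 3 - 3 * η ^ 2 = η ^ 2 * (4 * η - 3) := by ring
    rw [e, mul_pos_iff_of_pos_left h2]
    constructor <;> intro h <;> linarith
  refine ⟨⟨?_, ?_⟩, key⟩
  · rintro ⟨θ, -, h⟩
    have h3 := pos_of_mul_pos_right h (by positivity)
    apply key.1
    have h4 : 0 ≤ Real.tan (θ / 2) ^ 2 * (3 * η ^ 2) := by positivity
    linarith
  · intro h
    obtain ⟨t, ht⟩ : ∃ t : ℝ, t = (4 * η - 3) / 3 := ⟨_, rfl⟩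
    have ht0 : 0 < t := by rw [ht]; linarith
    have ha : 0 < Real.arctan t := Real.arctan_pos.2 ht0
    have hb := Real.arctan_lt_pi_div_two t
    have hm : 2 * Real.arctan t ∈ Set.Ioo 0 Real.pi := ⟨by linarith, by linarith⟩
    refine ⟨2 * Real.arctan t, hm, ?_⟩
    have hs := Real.sin_pos_of_pos_of_lt_pi hm.1 hm.2
    have e : 2 * Real.arctan t / 2 = Real.arctan t := by ring
    rw [e, Real.tan_arctan]
    have hd : 0 < 3 * Real.sin (2 * Real.arctan t) ^ 2
        + (1 - 3 * Real.cos (2 * Real.arctan t)) ^ 2 := by positivity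
    have hq := Real.sqrt_pos.2 hd
    have hc : 0 < 4 * η ^ 3 - 3 * η ^ 2 - t ^ 2 * (3 * η ^ 2) := by
      have e2 : 4 * η ^ 3 - 3 * η ^ 2 - t ^ 2 * (3 * η ^ 2) = 3 * η ^ 2 * (t * (1 - t)) := by
        have : η = (3 * t + 3) / 4 := by rw [ht]; ring
        rw [this]; ring
      rw [e2]
      have : 0 < 1 - t := by rw [ht]; linarith
      positivity
    exact mul_pos (by positivity) hc
end

section
/- Let η ∈ (0,1] and set η_A = η_B = 1 and η_C = η. Then there exists θ ∈ (0,π) with 2 k_θ² sin⁴θ · [4η − (1 + 2η) − tan²(θ/2)·(1 + 2η)] > 0 (where k_θ := sin θ / √(3 sin²θ + (1 − 3cos θ)²)) if and only if η > 1/2. Equivalently, 4η − 1 − 2η > 0 if and only if η > 1/2. -/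
/-- asymmetric-detector consequence of Theorem 1. With two
perfect detectors `ηA = ηB = 1` and a third of efficiency `η ∈ (0,1]`, the
one-parameter quantum settings exhibit a loophole-free `T₂` violation for some
`θ ∈ (0,π)` if and only if `η > 1/2`; equivalently, `4η − 1 − 2η > 0` iff `η > 1/2`. -/
theorem asymmetric_t2_mde_one_half
    (η : ℝ) (hη : 0 < η ∧ η ≤ 1) :
    ((∃ θ ∈ Set.Ioo 0 Real.pi,
        0 < 2 * (Real.sin θ / Real.sqrt (3 * Real.sin θ ^ 2 + (1 - 3 * Real.cos θ) ^ 2)) ^ 2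
            * Real.sin θ ^ 4
            * (4 * η - (1 + 2 * η) - Real.tan (θ / 2) ^ 2 * (1 + 2 * η)))
      ↔ 1 / 2 < η) ∧
    (0 < 4 * η - 1 - 2 * η ↔ 1 / 2 < η) := by
  obtain ⟨h0, h1⟩ := hη
  refine ⟨⟨?_, ?_⟩, ⟨fun h => by linarith, fun h => by linarith⟩⟩
  · rintro ⟨θ, _, h⟩
    by_contra hc
    have hc' : η ≤ 1 / 2 := not_lt.mp hc
    have hb : 4 * η - (1 + 2 * η) - Real.tan (θ / 2) ^ 2 * (1 + 2 * η) ≤ 0 := by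
      have : 0 ≤ Real.tan (θ / 2) ^ 2 * (1 + 2 * η) := by positivity
      linarith
    exact absurd h (not_lt.mpr (mul_nonpos_of_nonneg_of_nonpos (by positivity) hb))
  · intro h
    obtain ⟨t, ht⟩ : ∃ t : ℝ, t = (2 * η - 1) / (2 * (1 + 2 * η)) := ⟨_, rfl⟩
    have hp : 0 < 1 + 2 * η := by linarith
    have ht0 : 0 < t := by rw [ht]; apply div_pos <;> linarith
    have hte : t * (1 + 2 * η) = (2 * η - 1) / 2 := by rw [ht]; field_simp
    have ht1 : t < 1 := by rw [ht, div_lt_one (by linarith)]; linarith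
    have hlo : 0 < 2 * Real.arctan t := by
      have := Real.arctan_pos.mpr ht0
      linarith
    have hhi : 2 * Real.arctan t < Real.pi := by
      have := Real.arctan_lt_pi_div_two t
      linarith
    refine ⟨2 * Real.arctan t, ⟨hlo, hhi⟩, ?_⟩
    have hs : 0 < Real.sin (2 * Real.arctan t) := Real.sin_pos_of_pos_of_lt_pi hlo hhi
    have hT : Real.tan (2 * Real.arctan t / 2) = t := by
      rw [mul_div_cancel_left₀ _ (two_ne_zero), Real.tan_arctan]
    rw [hT]
    have hb : 0 < 4 * η - (1 + 2 * η) - t ^ 2 * (1 + 2 * η) := by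
      have : t ^ 2 * (1 + 2 * η) = t * ((2 * η - 1) / 2) := by rw [← hte]; ring
      rw [this]
      nlinarith
    have hq : 0 < Real.sqrt (3 * Real.sin (2 * Real.arctan t) ^ 2
        + (1 - 3 * Real.cos (2 * Real.arctan t)) ^ 2) := by
      apply Real.sqrt_pos.mpr
      positivity
    exact mul_pos (by positivity) hb
end
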